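/- Let q be a nonnegative integer, r = 16(3q+1), and k an integer with 0 ≤ k ≤ 16q+5. Let g : ℚ^r → ℚ^r be the linear map that cyclically permutes the coordinates within each of the k consecutive triples (x_1,x_2,x_3), (x_4,x_5,x_6), ..., (x_{3k-2},x_{3k-1},x_{3k}) and fixes all remaining coordinates. Then g maps Γ_r onto Γ_r, preserves the form B, satisfies g^3 = id, and Γ_r, regarded as a module over the group ring ℤ[ℤ/3ℤ] with a fixed generator acting as g, is isomorphic to the direct sum of k copies of ℤ[ℤ/3ℤ] and (r-3k) copies of ℤ with trivial action. -/

import Mathlib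

open scoped BigOperators

/-- The lattice `Γ_r`: vectors `x ∈ ((1/2)ℤ)^r` with `x_i - x_j ∈ ℤ` for all `i, j` and
`x_1 + ⋯ + x_r ∈ 2ℤ`, viewed as a `ℤ`-submodule of `ℚ^r`. -/
def gammaLattice (r : ℕ) : Submodule ℤ (Fin r → ℚ) where
  carrier := {x | (∀ i, ∃ a : ℤ, 2 * x i = a) ∧ (∀ i j, ∃ a : ℤ, x i - x j = a) ∧
      (∃ a : ℤ, ∑ i, x i = 2 * a)}
  zero_mem' := ⟨fun _ => ⟨0, by simp⟩, fun _ _ => ⟨0, by simp⟩, ⟨0, by simp⟩⟩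
  add_mem' := by
    rintro x y ⟨hx1, hx2, hx3⟩ ⟨hy1, hy2, hy3⟩
    refine ⟨fun i => ?_, fun i j => ?_, ?_⟩
    · obtain ⟨a, ha⟩ := hx1 i; obtain ⟨b, hb⟩ := hy1 i
      refine ⟨a + b, ?_⟩
      push_cast
      simp only [Pi.add_apply]
      linarith
    · obtain ⟨a, ha⟩ := hx2 i j; obtain ⟨b, hb⟩ := hy2 i j
      refine ⟨a + b, ?_⟩
      push_cast
      simp only [Pi.add_apply]
      linarith
    · obtain ⟨a, ha⟩ := hx3; obtain ⟨b, hb⟩ := hy3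
      refine ⟨a + b, ?_⟩
      push_cast
      simp only [Pi.add_apply, Finset.sum_add_distrib]
      linarith
  smul_mem' := by
    rintro c x ⟨hx1, hx2, hx3⟩
    refine ⟨fun i => ?_, fun i j => ?_, ?_⟩
    · obtain ⟨a, ha⟩ := hx1 i
      refine ⟨c * a, ?_⟩
      simp only [Pi.smul_apply, zsmul_eq_mul]
      push_cast
      linear_combination (c : ℚ) * ha
    · obtain ⟨a, ha⟩ := hx2 i j
      refine ⟨c * a, ?_⟩
      simp only [Pi.smul_apply, zsmul_eq_mul]
      push_cast
      linear_combination (c : ℚ) * ha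
    · obtain ⟨a, ha⟩ := hx3
      refine ⟨c * a, ?_⟩
      simp only [Pi.smul_apply, zsmul_eq_mul, ← Finset.mul_sum]
      push_cast
      linear_combination (c : ℚ) * ha

/-- The bilinear form `B(x,y) = -(x_1 y_1 + ⋯ + x_r y_r)` on `ℚ^r`. -/
def gform (r : ℕ) (x y : Fin r → ℚ) : ℚ := -∑ i, x i * y i

/-- The permutation of `Fin r` cyclically permuting the indices within each of the first `k`
consecutive triples and fixing all remaining indices. -/
def sigma3 (r k : ℕ) (h : 3 * k ≤ r) : Fin r → Fin r := fun i =>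
  if hi : (i : ℕ) < 3 * k then
    ⟨3 * ((i : ℕ) / 3) + (((i : ℕ) % 3 + 1) % 3), by omega⟩
  else i

/-- The linear map on `ℚ^r` cyclically permuting the coordinates within each of the first `k`
consecutive triples `(x_1,x_2,x_3), …, (x_{3k-2},x_{3k-1},x_{3k})` and fixing all remaining
coordinates. -/
def g3 (r k : ℕ) (h : 3 * k ≤ r) (x : Fin r → ℚ) : Fin r → ℚ := fun i => x (sigma3 r k h i)

def fmap (m : ℕ) (x : Fin (m + 4) → ℚ) (i : Fin (m + 4)) : ℚ :=
  if (i : ℕ) < 3 then (x 0 + x 1 + x 2) - x i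
  else if i = Fin.last (m + 3) then (∑ j, x j) / 2
  else x i - (x 0 + x 1 + x 2)

lemma fmap_add (m : ℕ) (x y : Fin (m + 4) → ℚ) (i) :
    fmap m (x + y) i = fmap m x i + fmap m y i := by
  unfold fmap
  simp only [Pi.add_apply, Finset.sum_add_distrib]
  split_ifs <;> ring

lemma fmap_smul (m : ℕ) (c : ℤ) (x : Fin (m + 4) → ℚ) (i) :
    fmap m (c • x) i = c * fmap m x i := by
  unfold fmap
  simp only [Pi.smul_apply, zsmul_eq_mul, ← Finset.mul_sum]
  split_ifs <;> ring

lemma fmap_int (m : ℕ) (x : Fin (m + 4) → ℚ) (hx : x ∈ gammaLattice (m + 4)) (i) :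
    ∃ a : ℤ, fmap m x i = a := by
  obtain ⟨h1, h2, h3⟩ := hx
  unfold fmap
  obtain ⟨a, ha⟩ := h1 0
  obtain ⟨b, hb⟩ := h2 1 0
  obtain ⟨c, hc⟩ := h2 2 0
  obtain ⟨d, hd⟩ := h2 i 0
  obtain ⟨s, hs⟩ := h3
  split_ifs
  · exact ⟨a + b + c - d, by push_cast; linarith⟩
  · exact ⟨s, by linarith⟩
  · exact ⟨d - a - b - c, by push_cast; linarith⟩

lemma fmap_floor (m : ℕ) (x : Fin (m + 4) → ℚ) (hx : x ∈ gammaLattice (m + 4)) (i) :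
    ((⌊fmap m x i⌋ : ℤ) : ℚ) = fmap m x i := by
  obtain ⟨a, ha⟩ := fmap_int m x hx i
  rw [ha, Int.floor_intCast]

lemma fmap_inj (m : ℕ) (x : Fin (m + 4) → ℚ) (h : ∀ i, fmap m x i = 0) : x = 0 := by
  have h0 := h 0
  have h1 := h 1
  have h2 := h 2
  have e1 : ((1 : Fin (m + 4)) : ℕ) = 1 := rfl
  have e2 : ((2 : Fin (m + 4)) : ℕ) = 2 := rfl
  simp only [fmap, Fin.val_zero, e1, e2] at h0 h1 h2
  norm_num at h0 h1 h2
  have hS : x 0 + x 1 + x 2 = 0 := by linarith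
  have key : ∀ i, i ≠ Fin.last (m + 3) → x i = 0 := by
    intro i hi
    have := h i
    unfold fmap at this
    rw [if_neg hi] at this
    split_ifs at this <;> linarith
  have hl := h (Fin.last (m + 3))
  unfold fmap at hl
  rw [if_neg (by simp), if_pos rfl, Fin.sum_univ_castSucc,
    Finset.sum_eq_zero (fun i _ => key _ (Fin.castSucc_lt_last i).ne)] at hl
  funext i
  by_cases hi : i = Fin.last (m + 3)
  · subst hi; simp only [Pi.zero_apply]; linarith
  · exact key i hi

lemma fmap_surj (m : ℕ) (hm : Even m) (c : Fin (m + 4) → ℤ) :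
    ∃ x ∈ gammaLattice (m + 4), ∀ i, fmap m x i = c i := by
  obtain ⟨n, rfl⟩ := hm
  set C : ℤ := c 0 + c 1 + c 2 with hC
  set d : Fin (n + n + 3) → ℤ := fun i =>
    if (i : ℕ) < 3 then - c i.castSucc else c i.castSucc with hd
  set xl : ℚ := 2 * c (Fin.last _) - ∑ i, ((C : ℚ) / 2 + d i) with hxl
  set x : Fin (n + n + 4) → ℚ := Fin.snoc (α := fun _ => ℚ) (fun i => (C : ℚ) / 2 + d i) xl with hx
  have xc : ∀ i : Fin (n + n + 3), x i.castSucc = (C : ℚ) / 2 + d i := by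
    intro i; simp [hx]
  have xL : x (Fin.last _) = xl := by simp [hx]
  have hsum : ∑ i, x i = 2 * c (Fin.last _) := by
    rw [Fin.sum_univ_castSucc, xL, hxl]
    simp only [xc]; ring
  have e : ∀ i, ∃ a : ℤ, x i = (C : ℚ) / 2 + a := by
    intro i
    refine Fin.lastCases ?_ (fun i => ⟨d i, xc i⟩) i
    refine ⟨2 * c (Fin.last _) - (n + 2) * C - ∑ i, d i, ?_⟩
    rw [xL, hxl, Finset.sum_add_distrib]
    simp only [Finset.sum_const, Finset.card_univ, Fintype.card_fin, nsmul_eq_mul]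
    push_cast
    ring
  have x0 : x 0 = (C : ℚ) / 2 - c 0 := by
    have := xc 0
    simp only [hd] at this
    simpa [sub_eq_add_neg] using this
  have x1 : x 1 = (C : ℚ) / 2 - c 1 := by
    have := xc ⟨1, by omega⟩
    simp only [hd] at this
    rw [if_pos (by simp)] at this
    have e1 : (Fin.castSucc ⟨1, by omega⟩ : Fin (n + n + 4)) = 1 := rfl
    rw [e1] at this
    rw [this]; push_cast; ring
  have x2 : x 2 = (C : ℚ) / 2 - c 2 := by
    have := xc ⟨2, by omega⟩
    simp only [hd] at this
    rw [if_pos (by simp)] at this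
    have e1 : (Fin.castSucc ⟨2, by omega⟩ : Fin (n + n + 4)) = 2 := rfl
    rw [e1] at this
    rw [this]; push_cast; ring
  have hS : x 0 + x 1 + x 2 = (C : ℚ) / 2 := by
    rw [x0, x1, x2, hC]; push_cast; ring
  refine ⟨x, ⟨?_, ?_, ⟨_, hsum⟩⟩, ?_⟩
  · intro i
    obtain ⟨a, ha⟩ := e i
    exact ⟨C + 2 * a, by rw [ha]; push_cast; ring⟩
  · intro i j
    obtain ⟨a, ha⟩ := e i
    obtain ⟨b, hb⟩ := e j
    exact ⟨a - b, by rw [ha, hb]; push_cast; ring⟩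
  · intro i
    unfold fmap
    rw [hS, hsum]
    refine Fin.lastCases ?_ (fun i => ?_) i
    · rw [if_neg (by simp), if_pos rfl]; ring
    · rw [xc, if_neg (Fin.castSucc_lt_last i).ne]
      simp only [hd, Fin.val_castSucc]
      split_ifs <;> push_cast <;> ring

lemma exists_e0 (m : ℕ) (hm : Even m) :
    ∃ e : gammaLattice (m + 4) ≃ₗ[ℤ] (Fin (m + 4) → ℤ),
      ∀ x i, ((e x i : ℤ) : ℚ) = fmap m x.1 i := by
  let A : gammaLattice (m + 4) →ₗ[ℤ] (Fin (m + 4) → ℤ) :=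
    { toFun := fun x i => ⌊fmap m x.1 i⌋
      map_add' := by
        intro x y
        funext i
        have : ((⌊fmap m (x + y).1 i⌋ : ℤ) : ℚ) = ((⌊fmap m x.1 i⌋ + ⌊fmap m y.1 i⌋ : ℤ) : ℚ) := by
          rw [Int.cast_add, fmap_floor m _ (x + y).2, fmap_floor m _ x.2, fmap_floor m _ y.2]
          exact fmap_add m x.1 y.1 i
        exact_mod_cast this
      map_smul' := by
        intro c x
        funext i
        have : ((⌊fmap m (c • x).1 i⌋ : ℤ) : ℚ) = ((c * ⌊fmap m x.1 i⌋ : ℤ) : ℚ) := by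
          rw [Int.cast_mul, fmap_floor m _ (c • x).2, fmap_floor m _ x.2]
          exact fmap_smul m c x.1 i
        exact_mod_cast this }
  have hA : ∀ x i, ((A x i : ℤ) : ℚ) = fmap m x.1 i := fun x i => fmap_floor m _ x.2 i
  refine ⟨LinearEquiv.ofBijective A ⟨?_, ?_⟩, hA⟩
  · rw [injective_iff_map_eq_zero]
    intro x hx
    apply Subtype.ext
    apply fmap_inj m
    intro i
    rw [← hA, hx]; simp
  · intro c
    obtain ⟨x, hx, hc⟩ := fmap_surj m hm c
    refine ⟨⟨x, hx⟩, ?_⟩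
    funext i
    have := hA ⟨x, hx⟩ i
    rw [hc] at this
    exact_mod_cast this

lemma sigma3_cube (r k : ℕ) (h : 3 * k ≤ r) (i : Fin r) :
    sigma3 r k h (sigma3 r k h (sigma3 r k h i)) = i := by
  apply Fin.ext
  by_cases hi : (i : ℕ) < 3 * k
  · have h1 : 3 * ((i : ℕ) / 3) + (((i : ℕ) % 3 + 1) % 3) < 3 * k := by omega
    have h2 : ∀ j : Fin r, (j : ℕ) < 3 * k →
      ((sigma3 r k h j : Fin r) : ℕ) = 3 * ((j : ℕ) / 3) + (((j : ℕ) % 3 + 1) % 3) := by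
      intro j hj; simp [sigma3, hj]
    have a1 := h2 i hi
    have a2 := h2 (sigma3 r k h i) (by omega)
    have a3 := h2 (sigma3 r k h (sigma3 r k h i)) (by omega)
    omega
  · simp [sigma3, hi]

lemma sigma3_bij (r k : ℕ) (h : 3 * k ≤ r) : Function.Bijective (sigma3 r k h) := by
  refine Function.bijective_iff_has_inverse.2 ⟨fun i => sigma3 r k h (sigma3 r k h i), ?_, ?_⟩
  · exact sigma3_cube r k h
  · exact sigma3_cube r k h

lemma sigma3_val (r k : ℕ) (h : 3 * k ≤ r) (i : Fin r) :
    ((sigma3 r k h i : Fin r) : ℕ) =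
      if (i : ℕ) < 3 * k then 3 * ((i : ℕ) / 3) + (((i : ℕ) % 3 + 1) % 3) else i := by
  unfold sigma3
  split_ifs <;> rfl

lemma sum_sigma3 (r k : ℕ) (h : 3 * k ≤ r) (f : Fin r → ℚ) :
    ∑ i, f (sigma3 r k h i) = ∑ i, f i :=
  (sigma3_bij r k h).sum_comp f

lemma fmap_g3 (m k : ℕ) (h : 3 * k ≤ m + 4) (h' : 3 * k ≤ m + 3) (x : Fin (m + 4) → ℚ) (i) :
    fmap m (g3 (m + 4) k h x) i = fmap m x (sigma3 (m + 4) k h i) := by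
  have hS : g3 (m + 4) k h x 0 + g3 (m + 4) k h x 1 + g3 (m + 4) k h x 2 = x 0 + x 1 + x 2 := by
    unfold g3
    have e1 : ((1 : Fin (m + 4)) : ℕ) = 1 := rfl
    have e2 : ((2 : Fin (m + 4)) : ℕ) = 2 := rfl
    by_cases hk : k = 0
    · have : ∀ i, sigma3 (m + 4) k h i = i := by
        intro i; apply Fin.ext; rw [sigma3_val, if_neg (by omega)]
      simp only [this]
    · have a0 : sigma3 (m + 4) k h 0 = 1 := by
        apply Fin.ext; rw [sigma3_val, Fin.val_zero, if_pos (by omega), e1]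
      have a1 : sigma3 (m + 4) k h 1 = 2 := by
        apply Fin.ext; rw [sigma3_val, e1, if_pos (by omega), e2]
      have a2 : sigma3 (m + 4) k h 2 = 0 := by
        apply Fin.ext; rw [sigma3_val, e2, if_pos (by omega), Fin.val_zero]
      rw [a0, a1, a2]; ring
  have hsum : ∑ j, g3 (m + 4) k h x j = ∑ j, x j := sum_sigma3 _ _ _ _
  have hlt : ((sigma3 (m + 4) k h i : Fin (m + 4)) : ℕ) < 3 ↔ (i : ℕ) < 3 := by
    rw [sigma3_val]; split_ifs <;> omega
  have hlast : sigma3 (m + 4) k h i = Fin.last (m + 3) ↔ i = Fin.last (m + 3) := by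
    rw [Fin.ext_iff, Fin.ext_iff, sigma3_val, Fin.val_last]; split_ifs <;> omega
  unfold fmap
  rw [hS, hsum]
  simp only [hlt, hlast]
  rfl

def posMap (r k : ℕ) (h : 3 * k ≤ r) : (Fin k × ZMod 3) ⊕ Fin (r - 3 * k) → Fin r :=
  Sum.elim (fun p => ⟨3 * (p.1 : ℕ) + (-p.2).val, by
      have := ZMod.val_lt (-p.2); have := p.1.2; omega⟩)
    (fun t => ⟨3 * k + (t : ℕ), by have := t.2; omega⟩)

lemma posMap_bij (r k : ℕ) (h : 3 * k ≤ r) : Function.Bijective (posMap r k h) := by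
  rw [Fintype.bijective_iff_injective_and_card]
  constructor
  · rintro (⟨j, i⟩ | t) (⟨j', i'⟩ | t') hh
    · have hv := congrArg Fin.val hh
      simp only [posMap, Sum.elim_inl] at hv
      have b1 := ZMod.val_lt (-i)
      have b2 := ZMod.val_lt (-i')
      have q1 : j = j' := Fin.ext (by omega)
      have q2 : (-i).val = (-i').val := by omega
      have q3 := neg_injective (ZMod.val_injective 3 q2)
      rw [q1, q3]
    · have hv := congrArg Fin.val hh
      simp only [posMap, Sum.elim_inl, Sum.elim_inr] at hv
      have b1 := ZMod.val_lt (-i)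
      have := j.2
      omega
    · have hv := congrArg Fin.val hh
      simp only [posMap, Sum.elim_inl, Sum.elim_inr] at hv
      have b1 := ZMod.val_lt (-i')
      have := j'.2
      omega
    · have hv := congrArg Fin.val hh
      simp only [posMap, Sum.elim_inr] at hv
      have q1 : t = t' := Fin.ext (by omega)
      rw [q1]
  · simp [ZMod.card]; omega

lemma sigma3_posMap_inl (r k : ℕ) (h : 3 * k ≤ r) (j : Fin k) (i : ZMod 3) :
    sigma3 r k h (posMap r k h (Sum.inl (j, i))) = posMap r k h (Sum.inl (j, i - 1)) := by
  apply Fin.ext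
  have v : ∀ i, (posMap r k h (Sum.inl (j, i)) : ℕ) = 3 * (j : ℕ) + (-i).val := fun _ => rfl
  have b1 := ZMod.val_lt (-i)
  have hj := j.2
  have key : ∀ i : ZMod 3, (-(i - 1)).val = ((-i).val + 1) % 3 := by decide
  rw [sigma3_val, if_pos (by rw [v]; omega), v, v, key]
  omega

lemma sigma3_posMap_inr (r k : ℕ) (h : 3 * k ≤ r) (t) :
    sigma3 r k h (posMap r k h (Sum.inr t)) = posMap r k h (Sum.inr t) := by
  apply Fin.ext
  have v : (posMap r k h (Sum.inr t) : ℕ) = 3 * k + (t : ℕ) := rfl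
  rw [sigma3_val, if_neg (by omega)]

def reshape (r k : ℕ) (h : 3 * k ≤ r) :
    (Fin r → ℤ) ≃ₗ[ℤ] ((Fin k → (ZMod 3 → ℤ)) × (Fin (r - 3 * k) → ℤ)) where
  toFun c := (fun j i => c (posMap r k h (Sum.inl (j, i))), fun t => c (posMap r k h (Sum.inr t)))
  map_add' _ _ := rfl
  map_smul' _ _ := rfl
  invFun d := fun i => Sum.elim (fun p => d.1 p.1 p.2) d.2
    ((Fintype.bijInv (posMap_bij r k h)) i)
  left_inv c := by
    funext i
    obtain ⟨s, rfl⟩ := (posMap_bij r k h).2 i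
    simp only [Fintype.leftInverse_bijInv (posMap_bij r k h) s]
    rcases s with ⟨j, i⟩ | t <;> rfl
  right_inv d := by
    simp only [Fintype.leftInverse_bijInv (posMap_bij r k h) _]
    rfl

/-- Lemma 3.2 : for `r = 16(3q+1)` and `0 ≤ k ≤ 16q+5`, the triple-cycling map `g` preserves
`Γ_r` and the form `B`, has order dividing `3`, and `Γ_r` as a `ℤ[ℤ/3ℤ]`-module (a generator
acting as `g`) is isomorphic to `k` copies of `ℤ[ℤ/3ℤ]` plus `r - 3k` trivial copies of `ℤ`. -/
theorem stmt2 (q r k : ℕ) (hr : r = 16 * (3 * q + 1)) (hk : k ≤ 16 * q + 5)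
    (h : 3 * k ≤ r) :
    (∀ x ∈ gammaLattice r, g3 r k h x ∈ gammaLattice r) ∧
    (∀ x y : Fin r → ℚ, gform r (g3 r k h x) (g3 r k h y) = gform r x y) ∧
    (g3 r k h ∘ g3 r k h ∘ g3 r k h = id) ∧
    ∃ e : gammaLattice r ≃ₗ[ℤ] ((Fin k → (ZMod 3 → ℤ)) × (Fin (r - 3 * k) → ℤ)),
      ∀ (x : gammaLattice r) (hx : g3 r k h x.1 ∈ gammaLattice r),
        e ⟨g3 r k h x.1, hx⟩ = ((fun j i => (e x).1 j (i - 1)), (e x).2) := by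
  refine ⟨?_, ?_, ?_, ?_⟩
  · rintro x ⟨h1, h2, h3⟩
    refine ⟨fun i => h1 _, fun i j => h2 _ _, ?_⟩
    have : ∑ i, g3 r k h x i = ∑ i, x i := sum_sigma3 _ _ _ _
    rw [this]; exact h3
  · intro x y
    unfold gform
    exact congrArg Neg.neg (sum_sigma3 r k h (fun i => x i * y i))
  · funext x i
    exact congrArg x (sigma3_cube r k h i)
  · obtain ⟨m, rfl⟩ : ∃ m, r = m + 4 := ⟨r - 4, by omega⟩
    obtain ⟨e, he⟩ := exists_e0 m (by rw [Nat.even_iff]; omega)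
    refine ⟨e.trans (reshape _ k h), fun x hx => ?_⟩
    have key : ∀ i, e ⟨g3 (m + 4) k h x.1, hx⟩ i = e x (sigma3 (m + 4) k h i) := by
      intro i
      have : ((e ⟨g3 (m + 4) k h x.1, hx⟩ i : ℤ) : ℚ) = (e x (sigma3 (m + 4) k h i) : ℤ) := by
        rw [he, he]
        exact fmap_g3 m k h (by omega) x.1 i
      exact_mod_cast this
    refine Prod.ext ?_ ?_
    · funext j i
      exact (key _).trans (congrArg (e x) (sigma3_posMap_inl _ k h j i))
    · funext t
      exact (key _).trans (congrArg (e x) (sigma3_posMap_inr _ k h t))
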